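/- arXiv:math/0401214 — 2 statements merged into one kernel-verified Lean document; each statement's English description precedes it below -/
import Mathlib

section
/- Let C be a K-coalgebra with coradical C₀ = ⊕_{i∈I} D^i, where the D^i are simple subcoalgebras of C. Then for all i, j ∈ I: (D^i ∧_C D^j) ∩ C₀ = D^i + D^j. -/
open TensorProduct

noncomputable section
namespace DG

variable (K : Type*) [Field K] (C : Type*) [AddCommGroup C] [Module K C] [Coalgebra K C]

/-- The image of `D ⊗ E` inside `C ⊗ C`, for submodules `D E : Submodule K C`. -/
def tsub (D E : Submodule K C) : Submodule K (C ⊗[K] C) :=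
  LinearMap.range (TensorProduct.map D.subtype E.subtype)

/-- The wedge `D ∧_C E = {c | Δ c ∈ D ⊗ C + C ⊗ E}` of two subspaces of a coalgebra. -/
def wedge (D E : Submodule K C) : Submodule K C :=
  (tsub K C D ⊤ ⊔ tsub K C ⊤ E).comap (Coalgebra.comul : C →ₗ[K] C ⊗[K] C)

/-- A subspace `D` is a subcoalgebra if `Δ(D) ⊆ D ⊗ D`. -/
def IsSubcoalgebra (D : Submodule K C) : Prop :=
  ∀ x ∈ D, (Coalgebra.comul : C →ₗ[K] C ⊗[K] C) x ∈ tsub K C D D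

/-- A simple subcoalgebra: a nonzero subcoalgebra with no nonzero proper subcoalgebras. -/
def IsSimpleSubcoalgebra (D : Submodule K C) : Prop :=
  IsSubcoalgebra K C D ∧ D ≠ ⊥ ∧
    ∀ E : Submodule K C, IsSubcoalgebra K C E → E ≤ D → E = ⊥ ∨ E = D

/-- The coradical `C₀`: the sum of all simple subcoalgebras. -/
def coradical : Submodule K C := sSup {D | IsSimpleSubcoalgebra K C D}

/-- `C₁ = C₀ ∧_C C₀`, the second term of the coradical filtration. -/
def C1 : Submodule K C := wedge K C (coradical K C) (coradical K C)

omit [Coalgebra K C] in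
variable {K C} in
lemma tsub_le_iff {D E : Submodule K C} {S : Submodule K (C ⊗[K] C)} :
    tsub K C D E ≤ S ↔ ∀ d ∈ D, ∀ e ∈ E, d ⊗ₜ[K] e ∈ S := by
  refine ⟨fun h d hd e he => h ⟨⟨d, hd⟩ ⊗ₜ ⟨e, he⟩, rfl⟩, fun h => ?_⟩
  rintro _ ⟨z, rfl⟩
  induction z with
  | zero => simp
  | tmul d e => exact h d d.2 e e.2
  | add x y hx hy => simpa using S.add_mem hx hy

omit [Coalgebra K C] in
variable {K C} in
lemma tsub_mono {D D' E E' : Submodule K C} (hD : D ≤ D') (hE : E ≤ E') :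
    tsub K C D E ≤ tsub K C D' E' :=
  tsub_le_iff.2 fun d hd e he => tsub_le_iff.1 le_rfl d (hD hd) e (hE he)

variable {K C} in
lemma IsSubcoalgebra.iSup {ι : Sort*} {D : ι → Submodule K C}
    (hD : ∀ i, IsSubcoalgebra K C (D i)) : IsSubcoalgebra K C (⨆ i, D i) := by
  change (⨆ i, D i) ≤ (tsub K C _ _).comap Coalgebra.comul
  exact iSup_le fun i x hx => tsub_mono (le_iSup D i) (le_iSup D i) (hD i x hx)

variable {K C} in
lemma IsSubcoalgebra.sup_le_wedge {D E : Submodule K C} (hD : IsSubcoalgebra K C D)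
    (hE : IsSubcoalgebra K C E) : D ⊔ E ≤ wedge K C D E :=
  sup_le
    (fun x hx => (tsub_mono le_rfl le_top).trans le_sup_left (hD x hx))
    (fun x hx => (tsub_mono le_top le_rfl).trans le_sup_right (hE x hx))

variable {K C} in
lemma eq_zero_of_comul_eq_zero {x : C} (hx : Coalgebra.comul (R := K) x = 0) : x = 0 := by
  have h := Coalgebra.rTensor_counit_comul (R := K) x
  rw [hx, map_zero] at h
  simpa using congrArg (TensorProduct.lid K C) h.symm

variable {K C} in
/-- A projection onto a complement of `D ⊔ E` containing `F` kills `D ⊗ C + C ⊗ E` and fixes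
`F ⊗ F`, so the comultiplication vanishes on `wedge D E ⊓ F`. -/
lemma IsSubcoalgebra.disjoint_wedge {D E F : Submodule K C} (hF : IsSubcoalgebra K C F)
    (h : Disjoint F (D ⊔ E)) : Disjoint (wedge K C D E) F := by
  obtain ⟨G, hFG, hG⟩ := h.exists_isCompl
  rw [Submodule.disjoint_def]
  intro x hxw hxF
  set p : C →ₗ[K] C := G.projection _ hG
  have hp : ∀ y ∈ D ⊔ E, p y = 0 := fun y hy => (Submodule.projection_apply_eq_zero_iff hG).2 hy
  have hzero : tsub K C D ⊤ ⊔ tsub K C ⊤ E ≤ LinearMap.ker (TensorProduct.map p p) :=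
    sup_le
      (tsub_le_iff.2 fun d hd e _ => by simp [hp d (Submodule.mem_sup_left hd)])
      (tsub_le_iff.2 fun d _ e he => by simp [hp e (Submodule.mem_sup_right he)])
  have hid : tsub K C F F ≤ LinearMap.eqLocus (TensorProduct.map p p) LinearMap.id :=
    tsub_le_iff.2 fun d hd e he => by
      have hd' : p d = d := Submodule.projection_apply_of_mem_left hG (hFG hd)
      have he' : p e = e := Submodule.projection_apply_of_mem_left hG (hFG he)
      simp [LinearMap.mem_eqLocus, hd', he']
  exact eq_zero_of_comul_eq_zero ((hid (hF x hxF)).symm.trans (hzero hxw))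

/-- **Statement 8** (Theorem 4.1(ii)): if the coradical `C₀` decomposes as the (internal) direct
sum `⊕_{i ∈ I} Dⁱ` of simple subcoalgebras, then `(Dⁱ ∧_C Dʲ) ∩ C₀ = Dⁱ + Dʲ` for all `i, j`. -/
theorem wedge_inf_coradical {K : Type*} [Field K] {C : Type*} [AddCommGroup C] [Module K C]
    [Coalgebra K C] {I : Type*} (D : I → Submodule K C)
    (hsimple : ∀ i, IsSimpleSubcoalgebra K C (D i))
    (hindep : iSupIndep D)
    (hsum : ⨆ i, D i = coradical K C) (i j : I) :
    wedge K C (D i) (D j) ⊓ coradical K C = D i ⊔ D j := by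
  have hD : ∀ k, IsSubcoalgebra K C (D k) := fun k => (hsimple k).1
  have hle := (hD i).sup_le_wedge (hD j)
  let F : Submodule K C := ⨆ k ∈ ({i, j} : Set I)ᶜ, D k
  have hF : IsSubcoalgebra K C F := .iSup fun k => .iSup fun _ => hD k
  have hpair : ⨆ k ∈ ({i, j} : Set I), D k = D i ⊔ D j := iSup_pair
  have hdisj : Disjoint F (D i ⊔ D j) := by
    rw [← hpair]
    exact (hindep.disjoint_biSup_biSup' disjoint_compl_right (Set.toFinite _)).symm
  have hcor : coradical K C = (D i ⊔ D j) ⊔ F := by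
    rw [← hsum, ← hpair, ← iSup_union, Set.union_compl_self, iSup_univ]
  rw [hcor, inf_comm, sup_inf_assoc_of_le F hle, inf_comm,
    (hF.disjoint_wedge hdisj).eq_bot, sup_bot_eq]

end DG
end
end

section
/- Let C be a K-coalgebra with coradical C₀ = ⊕_{i∈I} D^i, let V be a subspace with C = C₀ ⊕ V and ε(V) = 0, and define ε_i ∈ C* by ε_i|_{D^i} = ε and ε_i = 0 on D^j (j ≠ i) and on V. Then for every c ∈ C₁ and all i, j ∈ I one has ε_j ⇀ c ↼ ε_i ∈ D^i ∧_C D^j, and c = Σ_{i,j∈I} (ε_j ⇀ c ↼ ε_i). -/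
open TensorProduct

noncomputable section
namespace DG

variable (K : Type*) [Field K] (C : Type*) [AddCommGroup C] [Module K C] [Coalgebra K C]

/-- `f ⇀ c = Σ c₁ f(c₂)`, the left action of the dual algebra `C*` on `C`. -/
def lharpoon (f : Module.Dual K C) : C →ₗ[K] C :=
  (TensorProduct.rid K C).toLinearMap ∘ₗ (LinearMap.lTensor C f) ∘ₗ
    (Coalgebra.comul : C →ₗ[K] C ⊗[K] C)

/-- `c ↼ f = Σ f(c₁) c₂`, the right action of the dual algebra `C*` on `C`. -/
def rharpoon (f : Module.Dual K C) : C →ₗ[K] C :=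
  (TensorProduct.lid K C).toLinearMap ∘ₗ (LinearMap.rTensor C f) ∘ₗ
    (Coalgebra.comul : C →ₗ[K] C ⊗[K] C)

omit [Coalgebra K C] in
theorem tmul_mem_tsub {D E : Submodule K C} {x y : C} (hx : x ∈ D) (hy : y ∈ E) :
    x ⊗ₜ[K] y ∈ tsub K C D E :=
  ⟨⟨x, hx⟩ ⊗ₜ ⟨y, hy⟩, by simp⟩

omit [Coalgebra K C] in
theorem tsub_le {D E : Submodule K C} {N : Submodule K (C ⊗[K] C)}
    (h : ∀ x ∈ D, ∀ y ∈ E, x ⊗ₜ[K] y ∈ N) : tsub K C D E ≤ N := by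
  rintro _ ⟨s, rfl⟩
  induction s with
  | zero => simp
  | add s t hs ht => simpa using N.add_mem hs ht
  | tmul x y => simpa using h x x.2 y y.2

omit [Coalgebra K C] in
theorem tsub_le_comap_map {D E D' E' : Submodule K C} {φ ψ : C →ₗ[K] C}
    (hφ : D ≤ D'.comap φ) (hψ : E ≤ E'.comap ψ) :
    tsub K C D E ≤ (tsub K C D' E').comap (TensorProduct.map φ ψ) :=
  tsub_le K C fun _ hx _ hy => tmul_mem_tsub K C (Submodule.mem_comap.1 (hφ hx)) (hψ hy)

theorem comul_rharpoon (f : Module.Dual K C) (c : C) :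
    (Coalgebra.comul : C →ₗ[K] C ⊗[K] C) (rharpoon K C f c) =
      (rharpoon K C f).rTensor C (Coalgebra.comul c) := by
  have h₁ : ∀ t : C ⊗[K] C, (Coalgebra.comul : C →ₗ[K] C ⊗[K] C)
      (TensorProduct.lid K C (f.rTensor C t)) =
      TensorProduct.lid K (C ⊗[K] C)
        (f.rTensor (C ⊗[K] C) ((Coalgebra.comul : C →ₗ[K] C ⊗[K] C).lTensor C t)) := by
    intro t
    induction t with
    | zero => simp
    | add s t hs ht => simp only [map_add, hs, ht]
    | tmul x y => simp
  have h₂ : ∀ s : (C ⊗[K] C) ⊗[K] C,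
      ((TensorProduct.lid K C).toLinearMap ∘ₗ f.rTensor C).rTensor C s =
      TensorProduct.lid K (C ⊗[K] C)
        (f.rTensor (C ⊗[K] C) (TensorProduct.assoc K C C C s)) := by
    intro s
    induction s with
    | zero => simp
    | add s t hs ht => simp only [map_add, hs, ht]
    | tmul x y =>
      induction x with
      | zero => simp
      | add s t hs ht => simp only [TensorProduct.add_tmul, map_add, hs, ht]
      | tmul x z => simp [TensorProduct.smul_tmul']
  rw [rharpoon, ← LinearMap.comp_assoc, LinearMap.rTensor_comp_apply, h₂, Coalgebra.coassoc_apply]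
  exact h₁ _

theorem comul_lharpoon (f : Module.Dual K C) (c : C) :
    (Coalgebra.comul : C →ₗ[K] C ⊗[K] C) (lharpoon K C f c) =
      (lharpoon K C f).lTensor C (Coalgebra.comul c) := by
  have h₁ : ∀ t : C ⊗[K] C, (Coalgebra.comul : C →ₗ[K] C ⊗[K] C)
      (TensorProduct.rid K C (f.lTensor C t)) =
      TensorProduct.rid K (C ⊗[K] C)
        (f.lTensor (C ⊗[K] C) ((Coalgebra.comul : C →ₗ[K] C ⊗[K] C).rTensor C t)) := by
    intro t
    induction t with
    | zero => simp
    | add s t hs ht => simp only [map_add, hs, ht]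
    | tmul x y => simp
  have h₂ : ∀ s : C ⊗[K] (C ⊗[K] C),
      ((TensorProduct.rid K C).toLinearMap ∘ₗ f.lTensor C).lTensor C s =
      TensorProduct.rid K (C ⊗[K] C)
        (f.lTensor (C ⊗[K] C) ((TensorProduct.assoc K C C C).symm s)) := by
    intro s
    induction s with
    | zero => simp
    | add s t hs ht => simp only [map_add, hs, ht]
    | tmul x y =>
      induction y with
      | zero => simp
      | add s t hs ht => simp only [TensorProduct.tmul_add, map_add, hs, ht]
      | tmul y z => simp
  rw [lharpoon, ← LinearMap.comp_assoc, LinearMap.lTensor_comp_apply, h₂,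
    Coalgebra.coassoc_symm_apply]
  exact h₁ _

theorem comul_lharpoon_rharpoon (f g : Module.Dual K C) (c : C) :
    (Coalgebra.comul : C →ₗ[K] C ⊗[K] C) (lharpoon K C g (rharpoon K C f c)) =
      TensorProduct.map (rharpoon K C f) (lharpoon K C g) (Coalgebra.comul c) := by
  rw [comul_lharpoon, comul_rharpoon, ← LinearMap.comp_apply, LinearMap.lTensor_comp_rTensor]

section Subcoalgebra

variable {K C} {D : Submodule K C}

theorem IsSubcoalgebra.rharpoon_mem (hD : IsSubcoalgebra K C D) (f : Module.Dual K C) {x : C}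
    (hx : x ∈ D) : rharpoon K C f x ∈ D :=
  tsub_le K C (N := D.comap ((TensorProduct.lid K C).toLinearMap ∘ₗ f.rTensor C))
    (fun _ _ _ hy => by simpa using D.smul_mem _ hy) (hD x hx)

theorem IsSubcoalgebra.lharpoon_mem (hD : IsSubcoalgebra K C D) (f : Module.Dual K C) {x : C}
    (hx : x ∈ D) : lharpoon K C f x ∈ D :=
  tsub_le K C (N := D.comap ((TensorProduct.rid K C).toLinearMap ∘ₗ f.lTensor C))
    (fun _ hx _ _ => by simpa using D.smul_mem _ hx) (hD x hx)

theorem IsSubcoalgebra.rharpoon_eq_zero (hD : IsSubcoalgebra K C D) {f : Module.Dual K C}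
    (hf : ∀ x ∈ D, f x = 0) {x : C} (hx : x ∈ D) : rharpoon K C f x = 0 :=
  tsub_le K C (N := LinearMap.ker ((TensorProduct.lid K C).toLinearMap ∘ₗ f.rTensor C))
    (fun x hx _ _ => by simp [hf x hx]) (hD x hx)

theorem IsSubcoalgebra.lharpoon_eq_zero (hD : IsSubcoalgebra K C D) {f : Module.Dual K C}
    (hf : ∀ x ∈ D, f x = 0) {x : C} (hx : x ∈ D) : lharpoon K C f x = 0 :=
  tsub_le K C (N := LinearMap.ker ((TensorProduct.rid K C).toLinearMap ∘ₗ f.lTensor C))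
    (fun _ _ y hy => by simp [hf y hy]) (hD x hx)

end Subcoalgebra

section FinsumLocus

variable {K} {I M N P : Type*} [AddCommGroup M] [Module K M] [AddCommGroup N] [Module K N]
  [AddCommGroup P] [Module K P]

/-- The vectors at which the family `φ` is finitely supported with sum `ψ`. -/
def finsumLocus (φ : I → M →ₗ[K] N) (ψ : M →ₗ[K] N) : Submodule K M where
  carrier := {m | (Function.HasFiniteSupport fun i => φ i m) ∧ ∑ᶠ i, φ i m = ψ m}
  zero_mem' := by simp [Function.HasFiniteSupport]
  add_mem' := by
    rintro a b ⟨ha, ha'⟩ ⟨hb, hb'⟩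
    simp only [Set.mem_ofPred_eq, map_add]
    exact ⟨(ha.union hb).subset (Function.support_add _ _),
      by rw [finsum_add_distrib ha hb, ha', hb']⟩
  smul_mem' := by
    rintro r a ⟨ha, ha'⟩
    simp only [Set.mem_ofPred_eq, map_smul]
    exact ⟨ha.subset (Function.support_const_smul_subset r _), by rw [← smul_finsum' r ha, ha']⟩

theorem finsumLocus_comp_left (g : N →ₗ[K] P) {φ : I → M →ₗ[K] N} {ψ : M →ₗ[K] N} :
    finsumLocus φ ψ ≤ finsumLocus (fun i => g ∘ₗ φ i) (g ∘ₗ ψ) := by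
  rintro m ⟨hm, hm'⟩
  refine ⟨hm.subset fun i hi h => hi (by simp [h]), ?_⟩
  rw [LinearMap.comp_apply, ← hm']
  exact (g.toAddMonoidHom.map_finsum hm).symm

theorem finsumLocus_rTensor {φ : I → M →ₗ[K] N} {ψ : M →ₗ[K] N} (h : finsumLocus φ ψ = ⊤) :
    finsumLocus (fun i => (φ i).rTensor P) (ψ.rTensor P) = ⊤ := by
  refine eq_top_iff.2 fun t _ => ?_
  induction t with
  | zero => exact zero_mem _
  | add s t hs ht => exact add_mem (hs trivial) (ht trivial)
  | tmul x y =>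
    exact finsumLocus_comp_left ((TensorProduct.mk K N P).flip y) (h.ge (Submodule.mem_top (x := x)))

theorem finsumLocus_lTensor {φ : I → M →ₗ[K] N} {ψ : M →ₗ[K] N} (h : finsumLocus φ ψ = ⊤) :
    finsumLocus (fun i => (φ i).lTensor P) (ψ.lTensor P) = ⊤ := by
  refine eq_top_iff.2 fun t _ => ?_
  induction t with
  | zero => exact zero_mem _
  | add s t hs ht => exact add_mem (hs trivial) (ht trivial)
  | tmul x y =>
    exact finsumLocus_comp_left (TensorProduct.mk K P N x) (h.ge (Submodule.mem_top (x := y)))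

variable {C} {f : I → Module.Dual K C}

theorem finsumLocus_rharpoon (hf : finsumLocus f Coalgebra.counit = ⊤) :
    finsumLocus (fun i => rharpoon K C (f i)) LinearMap.id = ⊤ := by
  refine eq_top_iff.2 fun c _ => ?_
  have h := finsumLocus_comp_left (TensorProduct.lid K C).toLinearMap
    ((finsumLocus_rTensor (P := C) hf).ge (Submodule.mem_top (x := Coalgebra.comul c)))
  exact ⟨h.1, h.2.trans (by simp)⟩

theorem finsumLocus_lharpoon (hf : finsumLocus f Coalgebra.counit = ⊤) :
    finsumLocus (fun i => lharpoon K C (f i)) LinearMap.id = ⊤ := by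
  refine eq_top_iff.2 fun c _ => ?_
  have h := finsumLocus_comp_left (TensorProduct.rid K C).toLinearMap
    ((finsumLocus_lTensor (P := C) hf).ge (Submodule.mem_top (x := Coalgebra.comul c)))
  exact ⟨h.1, h.2.trans (by simp)⟩

theorem finite_support_lharpoon_rharpoon (hf : finsumLocus f Coalgebra.counit = ⊤) (c : C) :
    {p : I × I | lharpoon K C (f p.2) (rharpoon K C (f p.1) c) ≠ 0}.Finite := by
  have hR := ((finsumLocus_rharpoon hf).ge (Submodule.mem_top (x := c))).1
  have hL : ∀ x, (Function.HasFiniteSupport fun j => lharpoon K C (f j) x) := fun x =>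
    ((finsumLocus_lharpoon hf).ge (Submodule.mem_top (x := x))).1
  refine (hR.biUnion fun i _ => (hL (rharpoon K C (f i) c)).image (Prod.mk i)).subset ?_
  rintro ⟨i, j⟩ h
  exact Set.mem_biUnion (x := i) (fun h₀ => h (by simp_all)) ⟨j, h, rfl⟩

theorem finsum_lharpoon_rharpoon (hf : finsumLocus f Coalgebra.counit = ⊤) (c : C) :
    ∑ᶠ p : I × I, lharpoon K C (f p.2) (rharpoon K C (f p.1) c) = c := by
  rw [finsum_curry _ (finite_support_lharpoon_rharpoon hf c)]
  have hL : ∀ x, ∑ᶠ j, lharpoon K C (f j) x = x := fun x =>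
    ((finsumLocus_lharpoon hf).ge (Submodule.mem_top (x := x))).2
  simp only [hL]
  exact ((finsumLocus_rharpoon hf).ge (Submodule.mem_top (x := c))).2

end FinsumLocus

/-- **Statement 11** (key step in the proof of Theorem 4.1(i)): let `C₀ = ⊕_{i ∈ I} Dⁱ` with
`Dⁱ` simple subcoalgebras, let `V` be a vector space complement of `C₀` in `C` with `ε(V) = 0`,
and let `ε_i ∈ C*` agree with `ε` on `Dⁱ` and vanish on the `Dʲ (j ≠ i)` and on `V`. Then for
every `c ∈ C₁` each `ε_j ⇀ c ↼ ε_i` lies in `Dⁱ ∧_C Dʲ`, only finitely many of them are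
nonzero, and `c = Σ_{i,j ∈ I} (ε_j ⇀ c ↼ ε_i)`. -/
theorem harpoon_decomposition {K : Type*} [Field K] {C : Type*} [AddCommGroup C] [Module K C]
    [Coalgebra K C] {I : Type*} (D : I → Submodule K C)
    (hsimple : ∀ i, IsSimpleSubcoalgebra K C (D i))
    (hindep : iSupIndep D)
    (hsum : ⨆ i, D i = coradical K C)
    (V : Submodule K C) (hV : IsCompl (coradical K C) V)
    (hεV : ∀ v ∈ V, (Coalgebra.counit : C →ₗ[K] K) v = 0)
    (εf : I → Module.Dual K C)
    (hε₁ : ∀ i, ∀ x ∈ D i, εf i x = (Coalgebra.counit : C →ₗ[K] K) x)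
    (hε₂ : ∀ i j, i ≠ j → ∀ x ∈ D j, εf i x = 0)
    (hε₃ : ∀ i, ∀ v ∈ V, εf i v = 0)
    (c : C) (hc : c ∈ C1 K C) :
    (∀ i j : I, lharpoon K C (εf j) (rharpoon K C (εf i) c) ∈ wedge K C (D i) (D j)) ∧
    {p : I × I | lharpoon K C (εf p.2) (rharpoon K C (εf p.1) c) ≠ 0}.Finite ∧
    c = ∑ᶠ p : I × I, lharpoon K C (εf p.2) (rharpoon K C (εf p.1) c) := by
  have hf : finsumLocus εf Coalgebra.counit = ⊤ := by
    refine eq_top_iff.2 (hV.sup_eq_top.ge.trans (sup_le ?_ fun v hv => ?_))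
    · refine hsum.ge.trans (iSup_le fun k x hx => ?_)
      have h₀ : ∀ i, i ≠ k → εf i x = 0 := fun i hi => hε₂ i k hi x hx
      exact ⟨(Set.finite_singleton k).subset fun i hi => by_contra fun hik => hi (h₀ i hik),
        (finsum_eq_single _ k h₀).trans (hε₁ k x hx)⟩
    · simp [finsumLocus, Function.HasFiniteSupport, hε₃ _ v hv, hεV v hv]
  have hR : ∀ i, coradical K C ≤ (D i).comap (rharpoon K C (εf i)) := fun i =>
    hsum.ge.trans <| iSup_le fun k x hx => by
      rcases eq_or_ne i k with rfl | hik
      · exact (hsimple i).1.rharpoon_mem _ hx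
      · simp [(hsimple k).1.rharpoon_eq_zero (hε₂ i k hik) hx]
  have hL : ∀ j, coradical K C ≤ (D j).comap (lharpoon K C (εf j)) := fun j =>
    hsum.ge.trans <| iSup_le fun k x hx => by
      rcases eq_or_ne j k with rfl | hjk
      · exact (hsimple j).1.lharpoon_mem _ hx
      · simp [(hsimple k).1.lharpoon_eq_zero (hε₂ j k hjk) hx]
  refine ⟨fun i j => ?_, finite_support_lharpoon_rharpoon hf c, (finsum_lharpoon_rharpoon hf c).symm⟩
  rw [wedge, Submodule.mem_comap, comul_lharpoon_rharpoon, ← Submodule.mem_comap]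
  refine (sup_le ?_ ?_ : _ ≤ (_ : Submodule K (C ⊗[K] C))) hc
  · exact (tsub_le_comap_map K C (hR i) le_top).trans (Submodule.comap_mono le_sup_left)
  · exact (tsub_le_comap_map K C le_top (hL j)).trans (Submodule.comap_mono le_sup_right)

end DG
end
end
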